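/- arXiv:1001.3308 — 2 statements merged into one kernel-verified Lean document; each statement's English description precedes it below -/
import Mathlib

section
/- (Put–call parity for compound options.) Let ψ be an admissible characteristic exponent of order ν ∈ (0,2] and type [λ₋, λ₊] with λ₋ < −1 and λ₊ > 0, let r ∈ ℝ, t < T₁ < T₂, S, S*, K₁, K₂ > 0, w₂ ∈ {−1, 1}, and let ω₁, ω₂ > 0 satisfy ω₁ + ω₂ + 1 < min(λ₊, −λ₋). Set L* = ln(S/S*), L₂ = ln(S/K₂) and Ψ(ξ₁, ξ₂) = (T₁ − t)ψ(ξ₁ + ξ₂) + (T₂ − T₁)ψ(ξ₂). For w₁ ∈ {−1, 1} define F₂(w₁) = (S e^{−r(T₂−t)}/(2πi)²) ∫_{Im ξ₂ = −w₂ω₂} ∫_{Im ξ₁ = −w₁ω₁} e^{iξ₁L* + iξ₂L₂ − Ψ(ξ₁, ξ₂ − i)}/(ξ₁ξ₂) dξ₁ dξ₂ − (K₂ e^{−r(T₂−t)}/(2πi)²) ∫_{Im ξ₂ = −w₂ω₂} ∫_{Im ξ₁ = −w₁ω₁} e^{iξ₁L* + iξ₂L₂ − Ψ(ξ₁, ξ₂)}/(ξ₁ξ₂)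 dξ₁ dξ₂ − (K₁ e^{−r(T₁−t)}/(2πi)) ∫_{Im ξ₁ = −w₁ω₁} e^{iξ₁L* − (T₁−t)ψ(ξ₁)}/ξ₁ dξ₁, and define F₁ = (S e^{−r(T₂−t)}/(2πi)) ∫_{Im ξ₂ = −w₂ω₂} e^{iξ₂L₂ − (T₂−t)ψ(ξ₂ − i)}/ξ₂ dξ₂ − (K₂ e^{−r(T₂−t)}/(2πi)) ∫_{Im ξ₂ = −w₂ω₂} e^{iξ₂L₂ − (T₂−t)ψ(ξ₂)}/ξ₂ dξ₂. Then F₂(1) = F₂(−1) + F₁ − K₁ e^{−r(T₁−t)}. -/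
open MeasureTheory Real Complex ProbabilityTheory

/-- `ψ` is an admissible characteristic exponent of order `ν ∈ (0,2]` and type `[lm, lp]`
(`lm < 0 < lp`): continuous on the closed strip `lm ≤ Im ζ ≤ lp`, holomorphic in its
interior, vanishing at `0`, with `Re ψ(ζ) ≥ c|Re ζ|^ν − C` on the strip. -/
structure IsAdmissibleCharExponent (lm lp ν : ℝ) (ψ : ℂ → ℂ) : Prop where
  lm_neg : lm < 0
  lp_pos : 0 < lp
  ν_pos : 0 < ν
  ν_le_two : ν ≤ 2
  continuous : ContinuousOn ψ {ζ : ℂ | lm ≤ ζ.im ∧ ζ.im ≤ lp}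
  holomorphic : DifferentiableOn ℂ ψ {ζ : ℂ | lm < ζ.im ∧ ζ.im < lp}
  map_zero : ψ 0 = 0
  growth : ∃ c > 0, ∃ C ≥ 0, ∀ ζ : ℂ, lm ≤ ζ.im → ζ.im ≤ lp →
    c * |ζ.re| ^ ν - C ≤ (ψ ζ).re

/-- The compound-option pricing expression `F₂(w₁)` (contour-integral form), with inner
integration along `Im ξ₁ = −w₁ω₁` and outer integration along `Im ξ₂ = −w₂ω₂`. -/
noncomputable def F₂val (ψ : ℂ → ℂ) (r t T₁ T₂ S Sstar K₁ K₂ w₂ ω₁ ω₂ w₁ : ℝ) : ℂ :=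
  ((S : ℂ) * Real.exp (-r * (T₂ - t)) / (2 * Real.pi * Complex.I) ^ 2) *
    (∫ u₂ : ℝ, ∫ u₁ : ℝ,
      Complex.exp (Complex.I * ((u₁ : ℂ) - (w₁ * ω₁ : ℝ) * Complex.I) * (Real.log (S / Sstar) : ℝ)
          + Complex.I * ((u₂ : ℂ) - (w₂ * ω₂ : ℝ) * Complex.I) * (Real.log (S / K₂) : ℝ)
          - (((T₁ - t : ℝ) : ℂ) * ψ (((u₁ : ℂ) - (w₁ * ω₁ : ℝ) * Complex.I)
              + (((u₂ : ℂ) - (w₂ * ω₂ : ℝ) * Complex.I) - Complex.I))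
            + ((T₂ - T₁ : ℝ) : ℂ) * ψ (((u₂ : ℂ) - (w₂ * ω₂ : ℝ) * Complex.I) - Complex.I)))
        / (((u₁ : ℂ) - (w₁ * ω₁ : ℝ) * Complex.I) * ((u₂ : ℂ) - (w₂ * ω₂ : ℝ) * Complex.I)))
  - ((K₂ : ℂ) * Real.exp (-r * (T₂ - t)) / (2 * Real.pi * Complex.I) ^ 2) *
    (∫ u₂ : ℝ, ∫ u₁ : ℝ,
      Complex.exp (Complex.I * ((u₁ : ℂ) - (w₁ * ω₁ : ℝ) * Complex.I) * (Real.log (S / Sstar) : ℝ)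
          + Complex.I * ((u₂ : ℂ) - (w₂ * ω₂ : ℝ) * Complex.I) * (Real.log (S / K₂) : ℝ)
          - (((T₁ - t : ℝ) : ℂ) * ψ (((u₁ : ℂ) - (w₁ * ω₁ : ℝ) * Complex.I)
              + ((u₂ : ℂ) - (w₂ * ω₂ : ℝ) * Complex.I))
            + ((T₂ - T₁ : ℝ) : ℂ) * ψ ((u₂ : ℂ) - (w₂ * ω₂ : ℝ) * Complex.I)))
        / (((u₁ : ℂ) - (w₁ * ω₁ : ℝ) * Complex.I) * ((u₂ : ℂ) - (w₂ * ω₂ : ℝ) * Complex.I)))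
  - ((K₁ : ℂ) * Real.exp (-r * (T₁ - t)) / (2 * Real.pi * Complex.I)) *
    (∫ u₁ : ℝ,
      Complex.exp (Complex.I * ((u₁ : ℂ) - (w₁ * ω₁ : ℝ) * Complex.I) * (Real.log (S / Sstar) : ℝ)
          - ((T₁ - t : ℝ) : ℂ) * ψ ((u₁ : ℂ) - (w₁ * ω₁ : ℝ) * Complex.I))
        / ((u₁ : ℂ) - (w₁ * ω₁ : ℝ) * Complex.I))

/-- The value `F₁` of the underlying (vanilla) option in contour-integral form. -/
noncomputable def F₁val (ψ : ℂ → ℂ) (r t T₂ S K₂ w₂ ω₂ : ℝ) : ℂ :=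
  ((S : ℂ) * Real.exp (-r * (T₂ - t)) / (2 * Real.pi * Complex.I)) *
    (∫ u₂ : ℝ,
      Complex.exp (Complex.I * ((u₂ : ℂ) - (w₂ * ω₂ : ℝ) * Complex.I) * (Real.log (S / K₂) : ℝ)
          - ((T₂ - t : ℝ) : ℂ) * ψ (((u₂ : ℂ) - (w₂ * ω₂ : ℝ) * Complex.I) - Complex.I))
        / ((u₂ : ℂ) - (w₂ * ω₂ : ℝ) * Complex.I))
  - ((K₂ : ℂ) * Real.exp (-r * (T₂ - t)) / (2 * Real.pi * Complex.I)) *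
    (∫ u₂ : ℝ,
      Complex.exp (Complex.I * ((u₂ : ℂ) - (w₂ * ω₂ : ℝ) * Complex.I) * (Real.log (S / K₂) : ℝ)
          - ((T₂ - t : ℝ) : ℂ) * ψ ((u₂ : ℂ) - (w₂ * ω₂ : ℝ) * Complex.I))
        / ((u₂ : ℂ) - (w₂ * ω₂ : ℝ) * Complex.I))

/-- Stretched exponentials `exp (-a |u| ^ ν)` with `a, ν > 0` are integrable on `ℝ`. -/
lemma integrable_exp_neg_mul_abs_rpow {a ν : ℝ} (ha : 0 < a) (hν : 0 < ν) :
    Integrable fun u : ℝ => Real.exp (-a * |u| ^ ν) := by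
  have h : IntegrableOn (fun u : ℝ => Real.exp (-a * |u| ^ ν)) (Set.Ioi 0) := by
    refine (integrableOn_rpow_mul_exp_neg_mul_rpow (s := 0) (by norm_num) hν ha).congr_fun
      (fun x hx => ?_) measurableSet_Ioi
    simp [abs_of_pos (Set.mem_Ioi.1 hx)]
  rw [← integrableOn_univ, ← @Set.Iio_union_Ici _ _ (0 : ℝ), integrableOn_union,
    integrableOn_Ici_iff_integrableOn_Ioi]
  refine ⟨?_, h⟩
  rw [← (Measure.measurePreserving_neg (volume : Measure ℝ)).integrableOn_comp_preimage
    (Homeomorph.neg ℝ).measurableEmbedding]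
  simpa [Function.comp_def] using h

/-- The difference of the integrals of `1 / ζ` along `Im ζ = -ω` and `Im ζ = ω`. -/
lemma integral_inv_line_sub_inv_line {ω : ℝ} (hω : 0 < ω) :
    (Integrable fun u : ℝ => ((u : ℂ) - (ω : ℂ) * I)⁻¹ - ((u : ℂ) - ((-ω : ℝ) : ℂ) * I)⁻¹) ∧
    ∫ u : ℝ, (((u : ℂ) - (ω : ℂ) * I)⁻¹ - ((u : ℂ) - ((-ω : ℝ) : ℂ) * I)⁻¹)
      = 2 * Real.pi * I := by
  have key : (fun u : ℝ => ((u : ℂ) - (ω : ℂ) * I)⁻¹ - ((u : ℂ) - ((-ω : ℝ) : ℂ) * I)⁻¹)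
      = fun u : ℝ => (2 * I / (ω : ℂ)) * (((1 + (ω⁻¹ * u) ^ 2)⁻¹ : ℝ) : ℂ) := by
    funext u
    have h1 : (u : ℂ) - (ω : ℂ) * I ≠ 0 := fun h => hω.ne' (by simpa using congrArg Complex.im h)
    have h2 : (u : ℂ) + (ω : ℂ) * I ≠ 0 := fun h => hω.ne' (by simpa using congrArg Complex.im h)
    have h3 : (ω : ℂ) ≠ 0 := by exact_mod_cast hω.ne'
    have h5 : (ω : ℂ) ^ 2 + (u : ℂ) ^ 2 ≠ 0 := by
      have : 0 < ω ^ 2 + u ^ 2 := by positivity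
      exact_mod_cast this.ne'
    push_cast
    have h6 : (1 + ((ω : ℂ)⁻¹ * u) ^ 2)⁻¹ = (ω : ℂ) ^ 2 / ((ω : ℂ) ^ 2 + (u : ℂ) ^ 2) := by
      rw [inv_eq_one_div, div_eq_div_iff _ h5]
      · field_simp
      · have : 0 < 1 + (ω⁻¹ * u) ^ 2 := by positivity
        exact_mod_cast this.ne'
    have h7 : (ω : ℂ) ^ 2 + (u : ℂ) ^ 2 = ((u : ℂ) - ω * I) * ((u : ℂ) + ω * I) := by
      ring_nf
      rw [I_sq]
      ring
    rw [h6, h7, neg_mul, sub_neg_eq_add]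
    field_simp
    ring
  rw [key]
  refine ⟨((integrable_inv_one_add_sq.comp_mul_left' (inv_ne_zero hω.ne')).ofReal).const_mul _, ?_⟩
  rw [integral_const_mul, integral_complex_ofReal,
    Measure.integral_comp_mul_left (fun x : ℝ => (1 + x ^ 2)⁻¹), integral_univ_inv_one_add_sq]
  have h3 : (ω : ℂ) ≠ 0 := by exact_mod_cast hω.ne'
  rw [inv_inv, abs_of_pos hω, smul_eq_mul]
  push_cast
  field_simp

/-- Moving the line of integration of `f ζ / ζ` across the pole at the origin picks up
`2πi f(0)`. -/
lemma integral_line_div_sub_integral_line_div {f : ℂ → ℂ} {U : Set ℂ} {ω M : ℝ} (hω : 0 < ω)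
    (hU : IsOpen U) (hsub : ∀ ζ : ℂ, |ζ.im| ≤ ω → ζ ∈ U) (hf : DifferentiableOn ℂ f U)
    (hM : ∀ ζ : ℂ, |ζ.im| ≤ ω → ‖f ζ‖ ≤ M)
    (h1 : Integrable fun u : ℝ => f ((u : ℂ) - (ω : ℂ) * I) / ((u : ℂ) - (ω : ℂ) * I))
    (h2 : Integrable fun u : ℝ =>
      f ((u : ℂ) - ((-ω : ℝ) : ℂ) * I) / ((u : ℂ) - ((-ω : ℝ) : ℂ) * I)) :
    (∫ u : ℝ, f ((u : ℂ) - (ω : ℂ) * I) / ((u : ℂ) - (ω : ℂ) * I))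
      - ∫ u : ℝ, f ((u : ℂ) - ((-ω : ℝ) : ℂ) * I) / ((u : ℂ) - ((-ω : ℝ) : ℂ) * I)
      = 2 * Real.pi * I * f 0 := by
  have h0U : U ∈ nhds (0 : ℂ) := hU.mem_nhds (hsub 0 (by simpa using hω.le))
  have hg : DifferentiableOn ℂ (dslope f 0) U := (Complex.differentiableOn_dslope h0U).2 hf
  have hdiv : ∀ ζ : ℂ, ζ ≠ 0 → dslope f 0 ζ = f ζ / ζ - f 0 * ζ⁻¹ := by
    intro ζ hζ
    rw [dslope_of_ne _ hζ, slope_def_field, sub_zero, sub_div, div_eq_mul_inv (f 0)]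
  obtain ⟨hint, hval⟩ := integral_inv_line_sub_inv_line hω
  set D : ℝ → ℂ := fun u => dslope f 0 ((u : ℂ) - (ω : ℂ) * I)
    - dslope f 0 ((u : ℂ) - ((-ω : ℝ) : ℂ) * I) with hD
  have hDeq : D = fun u : ℝ =>
      (f ((u : ℂ) - (ω : ℂ) * I) / ((u : ℂ) - (ω : ℂ) * I)
        - f ((u : ℂ) - ((-ω : ℝ) : ℂ) * I) / ((u : ℂ) - ((-ω : ℝ) : ℂ) * I))
      - f 0 * (((u : ℂ) - (ω : ℂ) * I)⁻¹ - ((u : ℂ) - ((-ω : ℝ) : ℂ) * I)⁻¹) := by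
    funext u
    rw [hD]
    dsimp only
    rw [hdiv _ fun h => hω.ne' (by simpa using congrArg Complex.im h),
      hdiv _ fun h => hω.ne' (by simpa using congrArg Complex.im h)]
    ring
  have hDint : Integrable D := by
    rw [hDeq]
    exact (h1.sub h2).sub (hint.const_mul _)
  have hDval : ∫ u, D u = ((∫ u : ℝ, f ((u : ℂ) - (ω : ℂ) * I) / ((u : ℂ) - (ω : ℂ) * I))
      - ∫ u : ℝ, f ((u : ℂ) - ((-ω : ℝ) : ℂ) * I) / ((u : ℂ) - ((-ω : ℝ) : ℂ) * I))
      - 2 * Real.pi * I * f 0 := by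
    rw [hDeq]
    beta_reduce
    rw [integral_sub, integral_sub h1 h2, integral_const_mul, hval]
    · ring
    · exact h1.sub h2
    · exact hint.const_mul _
  have hline : ∀ y : ℝ, |y| ≤ ω → Continuous fun u : ℝ => dslope f 0 ((u : ℂ) + (y : ℂ) * I) := by
    intro y hy
    exact hg.continuousOn.comp_continuous (by fun_prop) fun u => hsub _ (by simpa using hy)
  have hM0 : 0 ≤ M := (norm_nonneg _).trans (hM 0 (by simpa using hω.le))
  have hside : ∀ x y : ℝ, 0 < |x| → |y| ≤ ω →
      ‖dslope f 0 ((x : ℂ) + (y : ℂ) * I)‖ ≤ 2 * M / |x| := by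
    intro x y hx hy
    have hre : |x| ≤ ‖(x : ℂ) + (y : ℂ) * I‖ := by
      simpa using Complex.abs_re_le_norm ((x : ℂ) + (y : ℂ) * I)
    have hne : (x : ℂ) + (y : ℂ) * I ≠ 0 := norm_pos_iff.1 (hx.trans_le hre)
    rw [dslope_of_ne _ hne, slope_def_field, sub_zero, norm_div]
    refine div_le_div₀ (by positivity) ?_ hx hre
    calc _ ≤ ‖f ((x : ℂ) + (y : ℂ) * I)‖ + ‖f 0‖ := norm_sub_le _ _
      _ ≤ M + M := add_le_add (hM _ (by simpa using hy)) (hM 0 (by simpa using hω.le))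
      _ = 2 * M := by ring
  have hbound : ∀ R : ℝ, 0 < R → ‖∫ u in (-R)..R, D u‖ ≤ 8 * M * ω / R := by
    intro R hR
    have hrect := Complex.integral_boundary_rect_eq_zero_of_differentiableOn (dslope f 0)
      (⟨-R, -ω⟩ : ℂ) (⟨R, ω⟩ : ℂ) (hg.mono fun ζ hζ => hsub ζ (by
        have := hζ.2
        rw [Set.mem_preimage, Set.uIcc_of_le (by linarith)] at this
        exact abs_le.2 this))
    dsimp only at hrect
    have hDR : ∫ u in (-R)..R, D u
        = (∫ x in (-R)..R, dslope f 0 ((x : ℂ) + ((-ω : ℝ) : ℂ) * I))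
          - ∫ x in (-R)..R, dslope f 0 ((x : ℂ) + (ω : ℂ) * I) := by
      rw [← intervalIntegral.integral_sub
        ((hline (-ω) (by rw [abs_neg, abs_of_pos hω])).intervalIntegrable _ _)
        ((hline ω (by rw [abs_of_pos hω])).intervalIntegrable _ _)]
      refine intervalIntegral.integral_congr fun u _ => ?_
      simp only [hD, ofReal_neg, neg_mul, neg_neg, sub_eq_add_neg]
    have hs : ∀ x : ℝ, |x| = R →
        ‖∫ y in (-ω)..ω, dslope f 0 ((x : ℂ) + (y : ℂ) * I)‖ ≤ 4 * M * ω / R := by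
      intro x hx
      refine (intervalIntegral.norm_integral_le_of_norm_le_const
        (C := 2 * M / R) fun y hy => ?_).trans_eq ?_
      · rw [Set.uIoc_of_le (by linarith)] at hy
        rw [← hx]
        exact hside x y (hx ▸ hR) (abs_le.2 ⟨hy.1.le, hy.2⟩)
      · rw [show ω - -ω = 2 * ω by ring, abs_of_pos (by positivity)]
        ring
    have e : ∫ u in (-R)..R, D u
        = I • (∫ y in (-ω)..ω, dslope f 0 (((-R : ℝ) : ℂ) + (y : ℂ) * I))
          - I • ∫ y in (-ω)..ω, dslope f 0 ((R : ℂ) + (y : ℂ) * I) := by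
      rw [hDR]
      linear_combination hrect
    rw [e]
    refine (norm_sub_le _ _).trans ?_
    rw [norm_smul, norm_smul, Complex.norm_I, one_mul, one_mul]
    refine (add_le_add (hs _ (by rw [abs_neg, abs_of_pos hR]))
      (hs _ (abs_of_pos hR))).trans_eq (by ring)
  have hlim := intervalIntegral_tendsto_integral hDint Filter.tendsto_neg_atTop_atBot
    Filter.tendsto_id
  have hzero : Filter.Tendsto (fun R : ℝ => ∫ u in (-R)..R, D u) Filter.atTop (nhds 0) :=
    squeeze_zero_norm' (by
      filter_upwards [Filter.eventually_gt_atTop 0] with R hR using hbound R hR)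
      (tendsto_const_nhds.div_atTop Filter.tendsto_id)
  have := tendsto_nhds_unique hlim hzero
  rw [hDval] at this
  linear_combination this

namespace IsAdmissibleCharExponent

variable {lm lp ν : ℝ} {ψ : ℂ → ℂ}

/-- Uniform decay of `exp (-A ψ)` on the strip. -/
lemma exists_norm_exp_neg_mul_le (hψ : IsAdmissibleCharExponent lm lp ν ψ) {A : ℝ} (hA : 0 < A) :
    ∃ a > 0, ∃ K > 0, ∀ ζ : ℂ, lm ≤ ζ.im → ζ.im ≤ lp →
      ‖cexp (-((A : ℂ) * ψ ζ))‖ ≤ K * Real.exp (-a * |ζ.re| ^ ν) := by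
  obtain ⟨c, hc, C, -, h⟩ := hψ.growth
  refine ⟨A * c, mul_pos hA hc, Real.exp (A * C), Real.exp_pos _, fun ζ h1 h2 => ?_⟩
  rw [Complex.norm_exp, ← Real.exp_add, neg_re, re_ofReal_mul]
  refine Real.exp_le_exp.2 ?_
  nlinarith [mul_le_mul_of_nonneg_left (h ζ h1 h2) hA.le]

/-- Shifting the contour of the one-dimensional pricing integral across its pole. -/
lemma integral_line_sub_integral_line (hψ : IsAdmissibleCharExponent lm lp ν ψ) {A ω : ℝ}
    (hA : 0 < A) (hω : 0 < ω) (L : ℝ) {η : ℂ} (h1 : lm < η.im - ω) (h2 : η.im + ω < lp) :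
    (∫ u : ℝ, cexp (I * ((u : ℂ) - (ω : ℂ) * I) * (L : ℂ)
        - (A : ℂ) * ψ (((u : ℂ) - (ω : ℂ) * I) + η)) / ((u : ℂ) - (ω : ℂ) * I))
      - (∫ u : ℝ, cexp (I * ((u : ℂ) - ((-ω : ℝ) : ℂ) * I) * (L : ℂ)
        - (A : ℂ) * ψ (((u : ℂ) - ((-ω : ℝ) : ℂ) * I) + η)) / ((u : ℂ) - ((-ω : ℝ) : ℂ) * I))
      = 2 * Real.pi * I * cexp (-((A : ℂ) * ψ η)) := by
  obtain ⟨a, ha, K, hK, hb⟩ := hψ.exists_norm_exp_neg_mul_le hA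
  set f : ℂ → ℂ := fun ζ => cexp (I * ζ * (L : ℂ) - (A : ℂ) * ψ (ζ + η)) with hf
  set U : Set ℂ := {ζ | lm < (ζ + η).im ∧ (ζ + η).im < lp}
  have hU : IsOpen U := by
    have him : Continuous fun ζ : ℂ => (ζ + η).im := by fun_prop
    exact (isOpen_lt continuous_const him).inter (isOpen_lt him continuous_const)
  have hsub : ∀ ζ : ℂ, |ζ.im| ≤ ω → ζ ∈ U := by
    intro ζ hζ
    have := abs_le.1 hζ
    constructor <;> rw [add_im] <;> linarith
  have hfd : DifferentiableOn ℂ f U := by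
    have : DifferentiableOn ℂ (fun ζ => ψ (ζ + η)) U :=
      hψ.holomorphic.comp (f := fun ζ : ℂ => ζ + η) (by fun_prop) fun ζ hζ => hζ
    exact (DifferentiableOn.sub (by fun_prop) (this.const_mul _)).cexp
  have hbd : ∀ ζ : ℂ, |ζ.im| ≤ ω →
      ‖f ζ‖ ≤ Real.exp (ω * |L|) * K * Real.exp (-a * |ζ.re + η.re| ^ ν) := by
    intro ζ hζ
    rw [hf]
    dsimp only
    rw [sub_eq_add_neg, Complex.exp_add, norm_mul, mul_assoc (Real.exp _)]
    refine mul_le_mul ?_ ?_ (norm_nonneg _) (Real.exp_pos _).le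
    · rw [Complex.norm_exp, Real.exp_le_exp]
      have : (I * ζ * (L : ℂ)).re = -(ζ.im * L) := by simp
      rw [this]
      calc _ ≤ |ζ.im * L| := neg_le_abs _
        _ ≤ _ := by rw [abs_mul]; gcongr
    · have := hsub ζ hζ
      simpa using hb (ζ + η) this.1.le this.2.le
  have hint : ∀ y : ℝ, y ≠ 0 → |y| ≤ ω →
      Integrable fun u : ℝ => f ((u : ℂ) - (y : ℂ) * I) / ((u : ℂ) - (y : ℂ) * I) := by
    intro y hy0 hy
    have hne : ∀ u : ℝ, (u : ℂ) - (y : ℂ) * I ≠ 0 :=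
      fun u h => hy0 (by simpa using congrArg Complex.im h)
    have hmem : ∀ u : ℝ, |((u : ℂ) - (y : ℂ) * I).im| ≤ ω := fun u => by simpa using hy
    have hy' : 0 < |y| := abs_pos.2 hy0
    refine Integrable.mono' ((((integrable_exp_neg_mul_abs_rpow ha hψ.ν_pos).comp_add_right
      η.re).const_mul (Real.exp (ω * |L|) * K)).div_const |y|) ?_ (.of_forall fun u => ?_)
    · refine (Continuous.div (hfd.continuousOn.comp_continuous (by fun_prop) fun u => ?_)
        (by fun_prop) hne).aestronglyMeasurable
      exact hsub _ (hmem u)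
    · rw [norm_div]
      refine div_le_div₀ (by positivity) ?_ hy' ?_
      · simpa using hbd _ (hmem u)
      · simpa using Complex.abs_im_le_norm ((u : ℂ) - (y : ℂ) * I)
  have := integral_line_div_sub_integral_line_div (M := Real.exp (ω * |L|) * K) hω hU hsub hfd
    (fun ζ hζ => (hbd ζ hζ).trans (mul_le_of_le_one_right (by positivity)
      (Real.exp_le_one_iff.2 (by
        rw [neg_mul]
        exact neg_nonpos.2 (by positivity)))))
    (hint ω hω.ne' (abs_of_pos hω).le)
    (hint (-ω) (neg_ne_zero.2 hω.ne') (by rw [abs_neg, abs_of_pos hω]))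
  rw [this, hf]
  simp

/-- Absolute convergence of the two-dimensional pricing integral. -/
lemma integrable_double (hψ : IsAdmissibleCharExponent lm lp ν ψ) {A B ω p : ℝ} {e : ℂ}
    (hA : 0 < A) (hB : 0 < B) (hω : ω ≠ 0) (hp : p ≠ 0) (he : e.re = 0) (L L₂ : ℝ)
    (h1 : lm ≤ -ω - p - e.im) (h2 : -ω - p - e.im ≤ lp)
    (h3 : lm ≤ -p - e.im) (h4 : -p - e.im ≤ lp) :
    Integrable (fun z : ℝ × ℝ =>
      cexp (I * ((z.2 : ℂ) - (ω : ℂ) * I) * (L : ℂ) + I * ((z.1 : ℂ) - (p : ℂ) * I) * (L₂ : ℂ)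
          - ((A : ℂ) * ψ (((z.2 : ℂ) - (ω : ℂ) * I) + (((z.1 : ℂ) - (p : ℂ) * I) - e))
            + (B : ℂ) * ψ (((z.1 : ℂ) - (p : ℂ) * I) - e)))
        / (((z.2 : ℂ) - (ω : ℂ) * I) * ((z.1 : ℂ) - (p : ℂ) * I)))
      (volume.prod volume) := by
  obtain ⟨a, ha, K, hK, hb⟩ := hψ.exists_norm_exp_neg_mul_le hA
  obtain ⟨b, hb0, K', hK', hb'⟩ := hψ.exists_norm_exp_neg_mul_le hB
  have hne1 : ∀ u : ℝ, (u : ℂ) - (ω : ℂ) * I ≠ 0 :=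
    fun u h => hω (by simpa using congrArg Complex.im h)
  have hne2 : ∀ u : ℝ, (u : ℂ) - (p : ℂ) * I ≠ 0 :=
    fun u h => hp (by simpa using congrArg Complex.im h)
  have him1 : ∀ u v : ℝ, (((u : ℂ) - (ω : ℂ) * I) + (((v : ℂ) - (p : ℂ) * I) - e)).im
      = -ω - p - e.im := fun u v => by
    simp
    ring
  have him2 : ∀ v : ℝ, (((v : ℂ) - (p : ℂ) * I) - e).im = -p - e.im := fun v => by simp
  have hmaj := (measurePreserving_prod_add (volume : Measure ℝ)
    (volume : Measure ℝ)).integrable_comp_of_integrable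
    ((integrable_exp_neg_mul_abs_rpow hb0 hψ.ν_pos).mul_prod
      (integrable_exp_neg_mul_abs_rpow ha hψ.ν_pos))
  refine (hmaj.const_mul
    (Real.exp (ω * L) * Real.exp (p * L₂) * K * K' / (|ω| * |p|))).mono' ?_
    (.of_forall fun z => ?_)
  · refine (Continuous.div (Continuous.cexp (Continuous.sub (by fun_prop)
      (((hψ.continuous.comp_continuous (by fun_prop) fun z => ?_).const_mul _).add
        ((hψ.continuous.comp_continuous (by fun_prop) fun z => ?_).const_mul _))))
      (by fun_prop) fun z => mul_ne_zero (hne1 _) (hne2 _)).aestronglyMeasurable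
    · exact ⟨(him1 _ _).symm ▸ h1, (him1 _ _).symm ▸ h2⟩
    · exact ⟨(him2 _).symm ▸ h3, (him2 _).symm ▸ h4⟩
  · have e1 := hb _ ((him1 z.2 z.1).symm ▸ h1) ((him1 z.2 z.1).symm ▸ h2)
    have e2 := hb' _ ((him2 z.1).symm ▸ h3) ((him2 z.1).symm ▸ h4)
    have r1 : (((z.2 : ℂ) - (ω : ℂ) * I) + (((z.1 : ℂ) - (p : ℂ) * I) - e)).re = z.1 + z.2 := by
      simp [he]
      ring
    have r2 : (((z.1 : ℂ) - (p : ℂ) * I) - e).re = z.1 := by simp [he]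
    rw [r1] at e1
    rw [r2] at e2
    have n1 : |ω| ≤ ‖(z.2 : ℂ) - (ω : ℂ) * I‖ := by
      simpa using Complex.abs_im_le_norm ((z.2 : ℂ) - (ω : ℂ) * I)
    have n2 : |p| ≤ ‖(z.1 : ℂ) - (p : ℂ) * I‖ := by
      simpa using Complex.abs_im_le_norm ((z.1 : ℂ) - (p : ℂ) * I)
    have m1 : ‖cexp (I * ((z.2 : ℂ) - (ω : ℂ) * I) * (L : ℂ))‖ = Real.exp (ω * L) := by
      simp [Complex.norm_exp]
    have m2 : ‖cexp (I * ((z.1 : ℂ) - (p : ℂ) * I) * (L₂ : ℂ))‖ = Real.exp (p * L₂) := by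
      simp [Complex.norm_exp]
    have hω' : 0 < |ω| := abs_pos.2 hω
    have hp' : 0 < |p| := abs_pos.2 hp
    rw [sub_eq_add_neg _ (_ + _), neg_add, Complex.exp_add, Complex.exp_add, Complex.exp_add,
      norm_div, norm_mul, norm_mul, norm_mul, norm_mul (_ - _), m1, m2]
    calc _ ≤ Real.exp (ω * L) * Real.exp (p * L₂) * ((K * Real.exp (-a * |z.1 + z.2| ^ ν))
          * (K' * Real.exp (-b * |z.1| ^ ν))) / (|ω| * |p|) := by gcongr
      _ = _ := by
        simp only [Function.comp_apply]
        ring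

/-- Shifting the inner contour of the two-dimensional pricing integral across its pole. -/
lemma integral_double_sub_integral_double (hψ : IsAdmissibleCharExponent lm lp ν ψ)
    {A B ω p : ℝ} {e : ℂ} (hA : 0 < A) (hB : 0 < B) (hω : 0 < ω) (hp : p ≠ 0) (he : e.re = 0)
    (L L₂ : ℝ) (h1 : lm < -p - e.im - ω) (h2 : -p - e.im + ω < lp) :
    (∫ v : ℝ, ∫ u : ℝ,
      cexp (I * ((u : ℂ) - (ω : ℂ) * I) * (L : ℂ) + I * ((v : ℂ) - (p : ℂ) * I) * (L₂ : ℂ)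
          - ((A : ℂ) * ψ (((u : ℂ) - (ω : ℂ) * I) + (((v : ℂ) - (p : ℂ) * I) - e))
            + (B : ℂ) * ψ (((v : ℂ) - (p : ℂ) * I) - e)))
        / (((u : ℂ) - (ω : ℂ) * I) * ((v : ℂ) - (p : ℂ) * I)))
    - (∫ v : ℝ, ∫ u : ℝ,
      cexp (I * ((u : ℂ) - ((-ω : ℝ) : ℂ) * I) * (L : ℂ) + I * ((v : ℂ) - (p : ℂ) * I) * (L₂ : ℂ)
          - ((A : ℂ) * ψ (((u : ℂ) - ((-ω : ℝ) : ℂ) * I) + (((v : ℂ) - (p : ℂ) * I) - e))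
            + (B : ℂ) * ψ (((v : ℂ) - (p : ℂ) * I) - e)))
        / (((u : ℂ) - ((-ω : ℝ) : ℂ) * I) * ((v : ℂ) - (p : ℂ) * I)))
    = 2 * Real.pi * I * ∫ v : ℝ,
      cexp (I * ((v : ℂ) - (p : ℂ) * I) * (L₂ : ℂ)
          - ((A + B : ℝ) : ℂ) * ψ (((v : ℂ) - (p : ℂ) * I) - e))
        / ((v : ℂ) - (p : ℂ) * I) := by
  have i1 := (hψ.integrable_double hA hB hω.ne' hp he L L₂ (by linarith) (by linarith)
    (by linarith) (by linarith)).integral_prod_left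
  have i2 := (hψ.integrable_double hA hB (neg_ne_zero.2 hω.ne') hp he L L₂ (by linarith)
    (by linarith) (by linarith) (by linarith)).integral_prod_left
  dsimp only at i1 i2
  rw [← integral_sub i1 i2, ← integral_const_mul]
  refine integral_congr_ae (.of_forall fun v => ?_)
  dsimp only
  set η : ℂ := ((v : ℂ) - (p : ℂ) * I) - e with hη
  have hηim : η.im = -p - e.im := by simp [hη]
  have key := hψ.integral_line_sub_integral_line hA hω L (η := η)
    (by rw [hηim]; exact h1) (by rw [hηim]; exact h2)
  have hfac : ∀ y : ℝ, (∫ u : ℝ,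
      cexp (I * ((u : ℂ) - (y : ℂ) * I) * (L : ℂ) + I * ((v : ℂ) - (p : ℂ) * I) * (L₂ : ℂ)
          - ((A : ℂ) * ψ (((u : ℂ) - (y : ℂ) * I) + η) + (B : ℂ) * ψ η))
        / (((u : ℂ) - (y : ℂ) * I) * ((v : ℂ) - (p : ℂ) * I)))
      = (cexp (I * ((v : ℂ) - (p : ℂ) * I) * (L₂ : ℂ) - (B : ℂ) * ψ η) / ((v : ℂ) - (p : ℂ) * I))
        * ∫ u : ℝ, cexp (I * ((u : ℂ) - (y : ℂ) * I) * (L : ℂ)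
          - (A : ℂ) * ψ (((u : ℂ) - (y : ℂ) * I) + η)) / ((u : ℂ) - (y : ℂ) * I) := by
    intro y
    rw [← integral_const_mul]
    refine integral_congr_ae (.of_forall fun u => ?_)
    dsimp only
    rw [div_mul_div_comm, ← Complex.exp_add, mul_comm ((u : ℂ) - _)]
    congr 2
    ring
  rw [hfac ω, hfac (-ω), ← mul_sub, key, mul_left_comm, div_mul_eq_mul_div, ← Complex.exp_add]
  congr 4
  push_cast
  ring

end IsAdmissibleCharExponent

/-- Put–call parity for compound options: `F₂(1) = F₂(−1) + F₁ − K₁ e^{−r(T₁−t)}`. -/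
theorem stmt9 (lm lp ν : ℝ) (ψ : ℂ → ℂ) (hψ : IsAdmissibleCharExponent lm lp ν ψ)
    (hlm : lm < -1) (hlp : 0 < lp) (r t T₁ T₂ S Sstar K₁ K₂ w₂ ω₁ ω₂ : ℝ)
    (ht : t < T₁) (hT : T₁ < T₂) (hS : 0 < S) (hSstar : 0 < Sstar)
    (hK₁ : 0 < K₁) (hK₂ : 0 < K₂) (hw₂ : w₂ = 1 ∨ w₂ = -1)
    (hω₁ : 0 < ω₁) (hω₂ : 0 < ω₂) (hsum : ω₁ + ω₂ + 1 < min lp (-lm)) :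
    F₂val ψ r t T₁ T₂ S Sstar K₁ K₂ w₂ ω₁ ω₂ 1
      = F₂val ψ r t T₁ T₂ S Sstar K₁ K₂ w₂ ω₁ ω₂ (-1)
        + F₁val ψ r t T₂ S K₂ w₂ ω₂
        - (K₁ : ℂ) * Real.exp (-r * (T₁ - t)) := by
  obtain ⟨hs1, hs2⟩ := lt_min_iff.1 hsum
  have hp : w₂ * ω₂ ≠ 0 := by
    rcases hw₂ with rfl | rfl <;> simp [hω₂.ne']
  have hp1 : w₂ * ω₂ ≤ ω₂ := by rcases hw₂ with rfl | rfl <;> linarith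
  have hp2 : -ω₂ ≤ w₂ * ω₂ := by rcases hw₂ with rfl | rfl <;> linarith
  have hA : 0 < T₁ - t := sub_pos.2 ht
  have hB : 0 < T₂ - T₁ := sub_pos.2 hT
  have hAB : T₁ - t + (T₂ - T₁) = T₂ - t := by ring
  have d1 := hψ.integral_double_sub_integral_double (e := I) hA hB hω₁ hp I_re
    (Real.log (S / Sstar)) (Real.log (S / K₂)) (by rw [I_im]; linarith) (by rw [I_im]; linarith)
  have d2 := hψ.integral_double_sub_integral_double (e := 0) hA hB hω₁ hp zero_re
    (Real.log (S / Sstar)) (Real.log (S / K₂)) (by rw [zero_im]; linarith)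
    (by rw [zero_im]; linarith)
  have d3 := hψ.integral_line_sub_integral_line hA hω₁ (Real.log (S / Sstar)) (η := 0)
    (by rw [zero_im]; linarith) (by rw [zero_im]; linarith)
  simp only [sub_zero, hAB] at d1 d2
  simp only [add_zero, hψ.map_zero, mul_zero, neg_zero, Complex.exp_zero, mul_one] at d3
  unfold F₂val F₁val
  simp only [one_mul, neg_one_mul]
  rw [sub_eq_iff_eq_add] at d1 d2 d3
  rw [d1, d2, d3]
  have alg : ∀ P : ℂ, P ≠ 0 → ∀ a b c X Y Z x y : ℂ,
      a / P ^ 2 * (P * x + X) - b / P ^ 2 * (P * y + Y) - c / P * (P + Z)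
        = a / P ^ 2 * X - b / P ^ 2 * Y - c / P * Z + (a / P * x - b / P * y) - c := by
    intro P hP a b c X Y Z x y
    field_simp
    ring
  exact alg _ Complex.two_pi_I_ne_zero _ _ _ _ _ _ _ _
end

section
/- (Simplification of the chooser option price by residues.) Let ψ be an admissible characteristic exponent of order ν ∈ (0,2] and type [λ₋, λ₊] with λ₋ < −1 and λ₊ > 0, and let r ∈ ℝ satisfy r + ψ(−i) = 0. Let t < T₁ < T, S, K > 0, set L₁ = ln(S/K) + r(T − T₁), L₂ = ln(S/K), and Ψ(ξ₁, ξ₂) = (T₁ − t)ψ(ξ₁ + ξ₂) + (T − T₁)ψ(ξ₂). Let ω₁, ω₂ > 0 with ω₁ + ω₂ + 1 < min(λ₊, −λ₋). Define A₁ = (S e^{−r(T−t)}/(2πi)²) ∫_{Im ξ₂ = −ω₂} ∫_{Im ξ₁ = −ω₁} e^{iξ₁L₁ + iξ₂L₂ − Ψ(ξ₁, ξ₂ − i)}/(ξ₁ξ₂) dξ₁ dξ₂ and A₄ = (S e^{−r(T−t)}/(2πi)²) ∫_{Im ξ₂ = +ω₂} ∫_{Im ξ₁ = +ω₁} e^{iξ₁L₁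 + iξ₂L₂ − Ψ(ξ₁, ξ₂ − i)}/(ξ₁ξ₂) dξ₁ dξ₂. Then A₁ = A₄ + (S e^{−r(T−t)}/(2πi)) ∫_{Im ξ₂ = −ω₂} e^{iξ₂L₂ − (T−t)ψ(ξ₂ − i)}/ξ₂ dξ₂ + (S e^{−r(T₁−t)}/(2πi)) ∫_{Im ξ₁ = +ω₁} e^{iξ₁L₁ − (T₁−t)ψ(ξ₁ − i)}/ξ₁ dξ₁. -/
open MeasureTheory Real Complex ProbabilityTheory

/-- The double contour integral appearing in the chooser-option price, with inner
integration along `Im ξ₁ = ρ₁` and outer integration along `Im ξ₂ = ρ₂`: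
`(S e^{−r(T−t)}/(2πi)²) ∫∫ e^{iξ₁L₁ + iξ₂L₂ − Ψ(ξ₁, ξ₂ − i)}/(ξ₁ξ₂) dξ₁ dξ₂`, where
`Ψ(ξ₁, ξ₂) = (T₁ − t)ψ(ξ₁ + ξ₂) + (T − T₁)ψ(ξ₂)`. -/
noncomputable def chooserDbl (ψ : ℂ → ℂ) (r t T₁ T L₁ L₂ S ρ₁ ρ₂ : ℝ) : ℂ :=
  ((S : ℂ) * Real.exp (-r * (T - t)) / (2 * Real.pi * Complex.I) ^ 2) *
    ∫ u₂ : ℝ, ∫ u₁ : ℝ,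
      Complex.exp (Complex.I * ((u₁ : ℂ) + (ρ₁ : ℂ) * Complex.I) * (L₁ : ℂ)
          + Complex.I * ((u₂ : ℂ) + (ρ₂ : ℂ) * Complex.I) * (L₂ : ℂ)
          - (((T₁ - t : ℝ) : ℂ) * ψ (((u₁ : ℂ) + (ρ₁ : ℂ) * Complex.I)
              + (((u₂ : ℂ) + (ρ₂ : ℂ) * Complex.I) - Complex.I))
            + ((T - T₁ : ℝ) : ℂ) * ψ (((u₂ : ℂ) + (ρ₂ : ℂ) * Complex.I) - Complex.I)))
        / (((u₁ : ℂ) + (ρ₁ : ℂ) * Complex.I) * ((u₂ : ℂ) + (ρ₂ : ℂ) * Complex.I))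

/-- The Cauchy kernels on the lines `Im = -a` and `Im = a` differ by an integrable function
of total mass `2πi`. -/
lemma integrable_and_integral_inv_line_sub {a : ℝ} (ha : 0 < a) :
    Integrable (fun u : ℝ => ((u : ℂ) + ((-a : ℝ) : ℂ) * I)⁻¹ - ((u : ℂ) + (a : ℂ) * I)⁻¹) ∧
    ∫ u : ℝ, (((u : ℂ) + ((-a : ℝ) : ℂ) * I)⁻¹ - ((u : ℂ) + (a : ℂ) * I)⁻¹)
      = 2 * Real.pi * I := by
  have h : (fun u : ℝ => ((u : ℂ) + ((-a : ℝ) : ℂ) * I)⁻¹ - ((u : ℂ) + (a : ℂ) * I)⁻¹)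
      = fun u : ℝ => (2 * I / a) * (((1 + (u / a) ^ 2)⁻¹ : ℝ) : ℂ) := by
    funext u
    have h₁ : (u : ℂ) + ((-a : ℝ) : ℂ) * I ≠ 0 := fun h => by
      have := congrArg Complex.im h
      simp at this
      linarith
    have h₂ : (u : ℂ) + (a : ℂ) * I ≠ 0 := fun h => by
      have := congrArg Complex.im h
      simp at this
      linarith
    have h₃ : (a : ℂ) ≠ 0 := by exact_mod_cast ha.ne'
    have h₄ : (1 : ℂ) + ((u : ℂ) / a) ^ 2
        = (u + ((-a : ℝ) : ℂ) * I) * (u + (a : ℂ) * I) / a ^ 2 := by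
      field_simp
      push_cast
      linear_combination (a : ℂ) ^ 2 * I_sq
    have h₅ : (u : ℂ) + (a : ℂ) * I - (u + ((-a : ℝ) : ℂ) * I) = 2 * I * a := by
      push_cast
      ring
    rw [inv_sub_inv h₁ h₂, h₅]
    push_cast at h₁ h₄ ⊢
    rw [h₄]
    field_simp
  rw [h]
  constructor
  · exact ((integrable_inv_one_add_sq.comp_div ha.ne').ofReal).const_mul _
  · rw [integral_const_mul, integral_complex_ofReal,
      Measure.integral_comp_div (fun x : ℝ => (1 + x ^ 2)⁻¹) a,
      integral_univ_inv_one_add_sq, abs_of_pos ha]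
    have h₃ : (a : ℂ) ≠ 0 := by exact_mod_cast ha.ne'
    simp only [smul_eq_mul]
    push_cast
    field_simp

/-- Residue formula for moving a horizontal contour across the simple pole of `g z / z`. -/
lemma integral_div_line_eq_add_residue {g : ℂ → ℂ} {a B : ℝ} (ha : 0 < a)
    (hg : DifferentiableOn ℂ g {z | |z.im| ≤ a}) (hB : ∀ z : ℂ, |z.im| ≤ a → ‖g z‖ ≤ B)
    (hlo : Integrable fun u : ℝ =>
      g ((u : ℂ) + ((-a : ℝ) : ℂ) * I) / ((u : ℂ) + ((-a : ℝ) : ℂ) * I))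
    (hhi : Integrable fun u : ℝ => g ((u : ℂ) + (a : ℂ) * I) / ((u : ℂ) + (a : ℂ) * I)) :
    ∫ u : ℝ, g ((u : ℂ) + ((-a : ℝ) : ℂ) * I) / ((u : ℂ) + ((-a : ℝ) : ℂ) * I)
      = (∫ u : ℝ, g ((u : ℂ) + (a : ℂ) * I) / ((u : ℂ) + (a : ℂ) * I))
        + 2 * Real.pi * I * g 0 := by
  obtain ⟨hki, hk⟩ := integrable_and_integral_inv_line_sub ha
  have hnhds : {z : ℂ | |z.im| ≤ a} ∈ nhds (0 : ℂ) :=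
    Filter.mem_of_superset ((isOpen_lt (by fun_prop : Continuous fun z : ℂ => |z.im|)
      continuous_const).mem_nhds (by simpa using ha)) fun z hz =>
        show |z.im| ≤ a from (show |z.im| < a from hz).le
  have hd : DifferentiableOn ℂ (dslope g 0) {z | |z.im| ≤ a} :=
    (Complex.differentiableOn_dslope hnhds).2 hg
  have hslope : ∀ z : ℂ, z ≠ 0 → dslope g 0 z = g z / z - g 0 * z⁻¹ := fun z hz => by
    rw [dslope_of_ne _ hz, slope_def_field, sub_zero]
    ring
  have hne : ∀ (b u : ℝ), b ≠ 0 → (u : ℂ) + (b : ℂ) * I ≠ 0 := fun b u hb h => hb (by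
    simpa using congrArg Complex.im h)
  have hne' : ∀ (b u : ℝ), b ≠ 0 → (b : ℂ) + (u : ℂ) * I ≠ 0 := fun b u hb h => hb (by
    simpa using congrArg Complex.re h)
  have hside : ∀ b : ℝ, b ≠ 0 →
      ‖∫ y : ℝ in (-a)..a, dslope g 0 ((b : ℂ) + (y : ℂ) * I)‖ ≤ 2 * B / |b| * |a - -a| := by
    intro b hb
    refine intervalIntegral.norm_integral_le_of_norm_le_const fun y hy => ?_
    rw [Set.uIoc_of_le (by linarith)] at hy
    have him : |((b : ℂ) + (y : ℂ) * I).im| ≤ a := by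
      simpa using abs_le.2 ⟨hy.1.le, hy.2⟩
    rw [dslope_of_ne _ (hne' b y hb), slope_def_field, sub_zero, norm_div]
    have hn : |b| ≤ ‖(b : ℂ) + (y : ℂ) * I‖ := by
      simpa using Complex.abs_re_le_norm ((b : ℂ) + (y : ℂ) * I)
    have hB₀ := hB 0 (by simpa using ha.le)
    have hB₁ := hB _ him
    have : ‖g ((b : ℂ) + (y : ℂ) * I) - g 0‖ ≤ 2 * B := (norm_sub_le _ _).trans (by linarith)
    have hbp : 0 < |b| := abs_pos.2 hb
    have : 0 ≤ B := (norm_nonneg _).trans hB₀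
    gcongr
  have hint : Integrable fun u : ℝ => dslope g 0 ((u : ℂ) + ((-a : ℝ) : ℂ) * I)
      - dslope g 0 ((u : ℂ) + (a : ℂ) * I) := by
    refine ((hlo.sub hhi).sub (hki.const_mul (g 0))).congr (.of_forall fun u => ?_)
    simp only [Pi.sub_apply]
    rw [hslope _ (hne _ u (neg_ne_zero.2 ha.ne')), hslope _ (hne _ u ha.ne')]
    ring
  have hcont : ∀ b : ℝ, |b| ≤ a → Continuous fun u : ℝ => dslope g 0 ((u : ℂ) + (b : ℂ) * I) :=
    fun b hb => hd.continuousOn.comp_continuous (by fun_prop) fun u => by simpa using hb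
  have hrect : ∀ R : ℝ, ∫ u : ℝ in (-R)..R, (dslope g 0 ((u : ℂ) + ((-a : ℝ) : ℂ) * I)
      - dslope g 0 ((u : ℂ) + (a : ℂ) * I))
      = I • (∫ y : ℝ in (-a)..a, dslope g 0 (((-R : ℝ) : ℂ) + (y : ℂ) * I))
        - I • (∫ y : ℝ in (-a)..a, dslope g 0 ((R : ℂ) + (y : ℂ) * I)) := by
    intro R
    have := Complex.integral_boundary_rect_eq_zero_of_differentiableOn (dslope g 0)
      ⟨-R, -a⟩ ⟨R, a⟩ (hd.mono fun z hz => by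
        have h₂ := hz.2
        simp only [Set.mem_preimage, Set.uIcc_of_le (by linarith : -a ≤ a)] at h₂
        exact abs_le.2 h₂)
    rw [intervalIntegral.integral_sub
      ((hcont _ (by rw [abs_neg, abs_of_pos ha])).intervalIntegrable _ _)
      ((hcont _ (abs_of_pos ha).le).intervalIntegrable _ _)]
    linear_combination this
  have hzero : ∫ u : ℝ, (dslope g 0 ((u : ℂ) + ((-a : ℝ) : ℂ) * I)
      - dslope g 0 ((u : ℂ) + (a : ℂ) * I)) = 0 := by
    refine tendsto_nhds_unique (intervalIntegral_tendsto_integral hint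
      Filter.tendsto_neg_atTop_atBot Filter.tendsto_id) ?_
    have hlim : Filter.Tendsto (fun R : ℝ => 2 * (2 * B * |a - -a|) / R) Filter.atTop (nhds 0) :=
      Filter.Tendsto.div_atTop tendsto_const_nhds Filter.tendsto_id
    refine squeeze_zero_norm' ?_ hlim
    filter_upwards [Filter.eventually_gt_atTop 0] with R hR
    have h₁ := hside R hR.ne'
    have h₂ := hside (-R) (neg_ne_zero.2 hR.ne')
    rw [abs_neg] at h₂
    rw [abs_of_pos hR] at h₁ h₂
    simp only [id]
    rw [hrect]
    refine (norm_sub_le _ _).trans ?_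
    rw [norm_smul, norm_smul, norm_I, one_mul, one_mul]
    refine (add_le_add h₂ h₁).trans (le_of_eq ?_)
    ring
  have hsplit : ∫ u : ℝ, (dslope g 0 ((u : ℂ) + ((-a : ℝ) : ℂ) * I)
      - dslope g 0 ((u : ℂ) + (a : ℂ) * I))
      = (∫ u : ℝ, g ((u : ℂ) + ((-a : ℝ) : ℂ) * I) / ((u : ℂ) + ((-a : ℝ) : ℂ) * I))
        - (∫ u : ℝ, g ((u : ℂ) + (a : ℂ) * I) / ((u : ℂ) + (a : ℂ) * I))
        - g 0 * (2 * Real.pi * I) := by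
    rw [← hk, ← integral_const_mul, ← integral_sub hlo hhi]
    refine Eq.trans (integral_congr_ae (.of_forall fun u => ?_))
      (integral_sub (hlo.sub hhi) (hki.const_mul (g 0)))
    simp only
    rw [hslope _ (hne _ u (neg_ne_zero.2 ha.ne')), hslope _ (hne _ u ha.ne')]
    ring
  rw [hzero] at hsplit
  linear_combination -hsplit

lemma integrable_exp_neg_mul_abs_rpow_s10 {b p : ℝ} (hb : 0 < b) (hp : 0 < p) :
    Integrable fun x : ℝ => Real.exp (-b * |x| ^ p) := by
  have hIoi : IntegrableOn (fun x : ℝ => Real.exp (-b * |x| ^ p)) (Set.Ioi 0) := by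
    refine (integrableOn_rpow_mul_exp_neg_mul_rpow (s := 0) (by norm_num) hp hb).congr_fun
      (fun x hx => ?_) measurableSet_Ioi
    simp [abs_of_pos (Set.mem_Ioi.1 hx)]
  have hIio : IntegrableOn (fun x : ℝ => Real.exp (-b * |x| ^ p)) (Set.Iio 0) := by
    simpa using IntegrableOn.comp_neg_Iio (c := (0 : ℝ))
      (f := fun x : ℝ => Real.exp (-b * |x| ^ p)) (by simpa using hIoi)
  rw [← integrableOn_univ, ← Set.Iio_union_Ici (a := (0 : ℝ))]
  exact hIio.union ((integrableOn_Ici_iff_integrableOn_Ioi).2 hIoi)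

/-- The numerator `e^{i z L₁ + i w L₂ − Ψ(z, w − i)}` of the chooser-option integrand, with
`Ψ(z, w) = τ₁ ψ(z + w) + τ₂ ψ(w)`. -/
noncomputable def chooserKernel (ψ : ℂ → ℂ) (τ₁ τ₂ L₁ L₂ : ℝ) (z w : ℂ) : ℂ :=
  Complex.exp (I * z * L₁ + I * w * L₂ - (τ₁ * ψ (z + (w - I)) + τ₂ * ψ (w - I)))

lemma differentiableOn_chooserKernel_left
    {lm lp ν : ℝ} {ψ : ℂ → ℂ} (hψ : IsAdmissibleCharExponent lm lp ν ψ)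
    {ω₁ ω₂ τ₁ τ₂ : ℝ} (L₁ L₂ : ℝ)
    (hlo : lm < -(ω₁ + ω₂ + 1)) (hup : ω₁ + ω₂ + 1 < lp)
    {w : ℂ} (hw : |w.im| ≤ ω₂) :
    DifferentiableOn ℂ (fun z => chooserKernel ψ τ₁ τ₂ L₁ L₂ z w) {z | |z.im| ≤ ω₁} := by
  have hw' := abs_le.1 hw
  have h : DifferentiableOn ℂ (fun z => ψ (z + (w - I))) {z | |z.im| ≤ ω₁} :=
    hψ.holomorphic.comp (f := fun z => z + (w - I)) (by fun_prop) fun z hz => by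
      have hz' := abs_le.1 (show |z.im| ≤ ω₁ from hz)
      constructor <;> simp <;> linarith
  exact ((by fun_prop : DifferentiableOn ℂ (fun z : ℂ => I * z * L₁ + I * w * L₂) _).sub
    ((h.const_mul (τ₁ : ℂ)).add (differentiableOn_const (τ₂ * ψ (w - I))))).cexp

lemma differentiableOn_chooserKernel_right
    {lm lp ν : ℝ} {ψ : ℂ → ℂ} (hψ : IsAdmissibleCharExponent lm lp ν ψ)
    {ω₁ ω₂ τ₁ τ₂ : ℝ} (L₁ L₂ : ℝ)
    (hlo : lm < -(ω₁ + ω₂ + 1)) (hup : ω₁ + ω₂ + 1 < lp)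
    {z : ℂ} (hz : |z.im| ≤ ω₁) :
    DifferentiableOn ℂ (fun w => chooserKernel ψ τ₁ τ₂ L₁ L₂ z w) {w | |w.im| ≤ ω₂} := by
  have hz' := abs_le.1 hz
  have h : DifferentiableOn ℂ (fun w => ψ (z + (w - I))) {w | |w.im| ≤ ω₂} :=
    hψ.holomorphic.comp (f := fun w => z + (w - I)) (by fun_prop) fun w hw => by
      have hw' := abs_le.1 (show |w.im| ≤ ω₂ from hw)
      constructor <;> simp <;> linarith
  have h' : DifferentiableOn ℂ (fun w => ψ (w - I)) {w | |w.im| ≤ ω₂} :=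
    hψ.holomorphic.comp (f := fun w => w - I) (by fun_prop) fun w hw => by
      have hw' := abs_le.1 (show |w.im| ≤ ω₂ from hw)
      constructor <;> simp <;> linarith
  exact ((by fun_prop : DifferentiableOn ℂ (fun w : ℂ => I * z * L₁ + I * w * L₂) _).sub
    ((h.const_mul (τ₁ : ℂ)).add (h'.const_mul (τ₂ : ℂ)))).cexp

lemma exists_norm_chooserKernel_le
    {lm lp ν : ℝ} {ψ : ℂ → ℂ} (hψ : IsAdmissibleCharExponent lm lp ν ψ)
    {ω₁ ω₂ τ₁ τ₂ : ℝ} (hτ₁ : 0 < τ₁) (hτ₂ : 0 < τ₂) (L₁ L₂ : ℝ)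
    (hlo : lm < -(ω₁ + ω₂ + 1)) (hup : ω₁ + ω₂ + 1 < lp)
    (hω₁ : 0 < ω₁) :
    ∃ b₁ > 0, ∃ b₂ > 0, ∃ B > 0, ∀ z w : ℂ, |z.im| ≤ ω₁ → |w.im| ≤ ω₂ →
      ‖chooserKernel ψ τ₁ τ₂ L₁ L₂ z w‖ ≤
        B * (Real.exp (-b₂ * |w.re| ^ ν) * Real.exp (-b₁ * |w.re + z.re| ^ ν)) := by
  obtain ⟨c, hc, C, -, h⟩ := hψ.growth
  refine ⟨τ₁ * c, by positivity, τ₂ * c, by positivity,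
    Real.exp (ω₁ * |L₁| + ω₂ * |L₂| + (τ₁ + τ₂) * C), Real.exp_pos _, fun z w hz hw => ?_⟩
  have hz' := abs_le.1 hz
  have hw' := abs_le.1 hw
  have h₁ := h (z + (w - I)) (by simp; linarith) (by simp; linarith)
  have h₂ := h (w - I) (by simp; linarith) (by simp; linarith)
  have h₃ : -(z.im * L₁) ≤ ω₁ * |L₁| := by
    refine (neg_le_abs _).trans ?_
    rw [abs_mul]
    gcongr
  have h₄ : -(w.im * L₂) ≤ ω₂ * |L₂| := by
    refine (neg_le_abs _).trans ?_
    rw [abs_mul]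
    gcongr
  simp only [add_re, sub_re, I_re, sub_zero] at h₁ h₂
  rw [chooserKernel, Complex.norm_exp, ← Real.exp_add, ← Real.exp_add]
  refine Real.exp_le_exp.2 ?_
  simp only [sub_re, add_re, mul_re, mul_im, I_re, I_im, ofReal_re, ofReal_im]
  rw [add_comm z.re] at h₁
  have h₅ := mul_le_mul_of_nonneg_left h₁ hτ₁.le
  have h₆ := mul_le_mul_of_nonneg_left h₂ hτ₂.le
  linarith

lemma integrable_chooserKernel_div
    {lm lp ν : ℝ} {ψ : ℂ → ℂ} (hψ : IsAdmissibleCharExponent lm lp ν ψ)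
    {ω₁ ω₂ τ₁ τ₂ : ℝ} (hτ₁ : 0 < τ₁) (hτ₂ : 0 < τ₂) (L₁ L₂ : ℝ)
    (hlo : lm < -(ω₁ + ω₂ + 1)) (hup : ω₁ + ω₂ + 1 < lp)
    (hω₁ : 0 < ω₁) {ρ₁ ρ₂ : ℝ} (h₁ : ρ₁ ≠ 0) (h₂ : ρ₂ ≠ 0)
    (hρ₁ : |ρ₁| ≤ ω₁) (hρ₂ : |ρ₂| ≤ ω₂) :
    Integrable (fun p : ℝ × ℝ => chooserKernel ψ τ₁ τ₂ L₁ L₂ (p.1 + ρ₁ * I) (p.2 + ρ₂ * I)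
      / (((p.1 : ℂ) + ρ₁ * I) * (p.2 + ρ₂ * I))) (volume.prod volume) := by
  obtain ⟨b₁, hb₁, b₂, hb₂, B, hB, hbound⟩ :=
    exists_norm_chooserKernel_le hψ hτ₁ hτ₂ L₁ L₂ hlo hup hω₁
  have hmaj : Integrable (fun p : ℝ × ℝ =>
      Real.exp (-b₂ * |p.2| ^ ν) * Real.exp (-b₁ * |p.2 + p.1| ^ ν)) (volume.prod volume) :=
    (measurePreserving_prod_add_swap volume volume).integrable_comp_of_integrable
      ((integrable_exp_neg_mul_abs_rpow_s10 hb₂ hψ.ν_pos).mul_prod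
        (integrable_exp_neg_mul_abs_rpow_s10 hb₁ hψ.ν_pos))
  have hne : ∀ {b : ℝ} (u : ℝ), b ≠ 0 → (u : ℂ) + (b : ℂ) * I ≠ 0 := fun u hb h => hb (by
    simpa using congrArg Complex.im h)
  have hn : ∀ b u : ℝ, |b| ≤ ‖(u : ℂ) + (b : ℂ) * I‖ := fun b u => by
    simpa using Complex.abs_im_le_norm ((u : ℂ) + (b : ℂ) * I)
  have hρ₁' := abs_le.1 hρ₁
  have hρ₂' := abs_le.1 hρ₂
  refine (hmaj.const_mul (B / (|ρ₁| * |ρ₂|))).mono' (Continuous.aestronglyMeasurable ?_)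
    (.of_forall fun p => ?_)
  · have hc₁ : Continuous fun p : ℝ × ℝ => ψ ((p.1 + ρ₁ * I) + ((p.2 + ρ₂ * I) - I)) :=
      hψ.continuous.comp_continuous (by fun_prop) fun p => by
        constructor <;> simp <;> linarith
    have hc₂ : Continuous fun p : ℝ × ℝ => ψ ((p.2 + ρ₂ * I) - I) :=
      hψ.continuous.comp_continuous (by fun_prop) fun p => by
        constructor <;> simp <;> linarith
    refine Continuous.div ?_ (by fun_prop) fun p => mul_ne_zero (hne _ h₁) (hne _ h₂)
    exact ((by fun_prop : Continuous fun p : ℝ × ℝ =>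
      I * (p.1 + ρ₁ * I) * L₁ + I * (p.2 + ρ₂ * I) * L₂).sub
        ((hc₁.const_mul (τ₁ : ℂ)).add (hc₂.const_mul (τ₂ : ℂ)))).cexp
  · have h := hbound (p.1 + ρ₁ * I) (p.2 + ρ₂ * I) (by simpa using hρ₁) (by simpa using hρ₂)
    simp only [add_re, ofReal_re, mul_re, I_re, mul_zero, ofReal_im, I_im, mul_one, sub_self,
      add_zero] at h
    rw [norm_div, norm_mul, div_mul_eq_mul_div]
    have := abs_pos.2 h₁
    have := abs_pos.2 h₂
    gcongr
    · exact hn _ _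
    · exact hn _ _

lemma exists_norm_chooserKernel_le_const
    {lm lp ν : ℝ} {ψ : ℂ → ℂ} (hψ : IsAdmissibleCharExponent lm lp ν ψ)
    {ω₁ ω₂ τ₁ τ₂ : ℝ} (hτ₁ : 0 < τ₁) (hτ₂ : 0 < τ₂) (L₁ L₂ : ℝ)
    (hlo : lm < -(ω₁ + ω₂ + 1)) (hup : ω₁ + ω₂ + 1 < lp)
    (hω₁ : 0 < ω₁) :
    ∃ B : ℝ, ∀ z w : ℂ, |z.im| ≤ ω₁ → |w.im| ≤ ω₂ →
      ‖chooserKernel ψ τ₁ τ₂ L₁ L₂ z w‖ ≤ B := by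
  obtain ⟨b₁, hb₁, b₂, hb₂, B, hB, hbound⟩ :=
    exists_norm_chooserKernel_le hψ hτ₁ hτ₂ L₁ L₂ hlo hup hω₁
  have hexp : ∀ {b : ℝ} (x : ℝ), 0 < b → Real.exp (-b * |x| ^ ν) ≤ 1 := fun {b} x hb => by
    rw [Real.exp_le_one_iff, neg_mul, neg_nonpos]
    positivity
  refine ⟨B * (1 * 1), fun z w hz hw => (hbound z w hz hw).trans ?_⟩
  gcongr
  · exact hexp _ hb₂
  · exact hexp _ hb₁

/-- Moving the inner contour across `z = 0`. -/
lemma integral_chooserKernel_shift_left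
    {lm lp ν : ℝ} {ψ : ℂ → ℂ} (hψ : IsAdmissibleCharExponent lm lp ν ψ)
    {ω₁ ω₂ τ₁ τ₂ : ℝ} (hτ₁ : 0 < τ₁) (hτ₂ : 0 < τ₂) (L₁ L₂ : ℝ)
    (hlo : lm < -(ω₁ + ω₂ + 1)) (hup : ω₁ + ω₂ + 1 < lp)
    (hω₁ : 0 < ω₁) {ρ₂ : ℝ} (h₂ : ρ₂ ≠ 0)
    (hρ₂ : |ρ₂| ≤ ω₂) :
    ∫ u₂ : ℝ, ∫ u₁ : ℝ,
        chooserKernel ψ τ₁ τ₂ L₁ L₂ (u₁ + (-ω₁ : ℝ) * I) (u₂ + ρ₂ * I)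
          / (((u₁ : ℂ) + (-ω₁ : ℝ) * I) * (u₂ + ρ₂ * I))
      = (∫ u₂ : ℝ, ∫ u₁ : ℝ, chooserKernel ψ τ₁ τ₂ L₁ L₂ (u₁ + ω₁ * I) (u₂ + ρ₂ * I)
          / (((u₁ : ℂ) + ω₁ * I) * (u₂ + ρ₂ * I)))
        + 2 * Real.pi * I *
          ∫ u₂ : ℝ, chooserKernel ψ τ₁ τ₂ L₁ L₂ 0 (u₂ + ρ₂ * I) / ((u₂ : ℂ) + ρ₂ * I) := by
  obtain ⟨B, hB⟩ := exists_norm_chooserKernel_le_const hψ hτ₁ hτ₂ L₁ L₂ hlo hup hω₁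
  have hA := integrable_chooserKernel_div hψ hτ₁ hτ₂ L₁ L₂ hlo hup hω₁
    (neg_ne_zero.2 hω₁.ne') h₂ (by rw [abs_neg, abs_of_pos hω₁]) hρ₂
  have hD := integrable_chooserKernel_div hψ hτ₁ hτ₂ L₁ L₂ hlo hup hω₁ hω₁.ne' h₂
    (abs_of_pos hω₁).le hρ₂
  have key : ∀ᵐ u₂ : ℝ, ∫ u₁ : ℝ,
        chooserKernel ψ τ₁ τ₂ L₁ L₂ (u₁ + (-ω₁ : ℝ) * I) (u₂ + ρ₂ * I)
          / (((u₁ : ℂ) + (-ω₁ : ℝ) * I) * (u₂ + ρ₂ * I))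
      = (∫ u₁ : ℝ, chooserKernel ψ τ₁ τ₂ L₁ L₂ (u₁ + ω₁ * I) (u₂ + ρ₂ * I)
          / (((u₁ : ℂ) + ω₁ * I) * (u₂ + ρ₂ * I)))
        + 2 * Real.pi * I *
          (chooserKernel ψ τ₁ τ₂ L₁ L₂ 0 (u₂ + ρ₂ * I) / ((u₂ : ℂ) + ρ₂ * I)) := by
    filter_upwards [hA.prod_left_ae, hD.prod_left_ae] with u₂ iA iD
    have hw : |((u₂ : ℂ) + ρ₂ * I).im| ≤ ω₂ := by simpa using hρ₂
    set w : ℂ := (u₂ : ℂ) + ρ₂ * I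
    have hres := integral_div_line_eq_add_residue (B := B / ‖w‖)
      (g := fun z => chooserKernel ψ τ₁ τ₂ L₁ L₂ z w / w) hω₁
      ((differentiableOn_chooserKernel_left hψ L₁ L₂ hlo hup hw).div_const w)
      (fun z hz => by
        rw [norm_div]
        gcongr
        exact hB z w hz hw)
      (by simpa only [div_div, mul_comm w] using iA) (by simpa only [div_div, mul_comm w] using iD)
    simpa only [div_div, mul_comm w] using hres
  have hsum := integral_congr_ae key
  have hres : Integrable fun u₂ : ℝ => 2 * Real.pi * I *
      (chooserKernel ψ τ₁ τ₂ L₁ L₂ 0 (u₂ + ρ₂ * I) / ((u₂ : ℂ) + ρ₂ * I)) := by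
    refine (hA.integral_prod_right.sub hD.integral_prod_right).congr ?_
    filter_upwards [key] with u₂ hu₂
    simp only [Pi.sub_apply]
    rw [hu₂]
    ring
  rw [hsum, integral_add hD.integral_prod_right hres, integral_const_mul]

/-- Moving the outer contour across `w = 0`. -/
lemma integral_chooserKernel_shift_right
    {lm lp ν : ℝ} {ψ : ℂ → ℂ} (hψ : IsAdmissibleCharExponent lm lp ν ψ)
    {ω₁ ω₂ τ₁ τ₂ : ℝ} (hτ₁ : 0 < τ₁) (hτ₂ : 0 < τ₂) (L₁ L₂ : ℝ)
    (hlo : lm < -(ω₁ + ω₂ + 1)) (hup : ω₁ + ω₂ + 1 < lp)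
    (hω₁ : 0 < ω₁) (hω₂ : 0 < ω₂) {ρ₁ : ℝ} (h₁ : ρ₁ ≠ 0)
    (hρ₁ : |ρ₁| ≤ ω₁) :
    ∫ u₂ : ℝ, ∫ u₁ : ℝ,
        chooserKernel ψ τ₁ τ₂ L₁ L₂ (u₁ + ρ₁ * I) (u₂ + (-ω₂ : ℝ) * I)
          / (((u₁ : ℂ) + ρ₁ * I) * (u₂ + (-ω₂ : ℝ) * I))
      = (∫ u₂ : ℝ, ∫ u₁ : ℝ, chooserKernel ψ τ₁ τ₂ L₁ L₂ (u₁ + ρ₁ * I) (u₂ + ω₂ * I)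
          / (((u₁ : ℂ) + ρ₁ * I) * (u₂ + ω₂ * I)))
        + 2 * Real.pi * I *
          ∫ u₁ : ℝ, chooserKernel ψ τ₁ τ₂ L₁ L₂ (u₁ + ρ₁ * I) 0 / ((u₁ : ℂ) + ρ₁ * I) := by
  obtain ⟨B, hB⟩ := exists_norm_chooserKernel_le_const hψ hτ₁ hτ₂ L₁ L₂ hlo hup hω₁
  have hA := integrable_chooserKernel_div hψ hτ₁ hτ₂ L₁ L₂ hlo hup hω₁ h₁
    (neg_ne_zero.2 hω₂.ne') hρ₁ (by rw [abs_neg, abs_of_pos hω₂])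
  have hD := integrable_chooserKernel_div hψ hτ₁ hτ₂ L₁ L₂ hlo hup hω₁ h₁ hω₂.ne'
    hρ₁ (abs_of_pos hω₂).le
  have key : ∀ᵐ u₁ : ℝ, ∫ u₂ : ℝ,
        chooserKernel ψ τ₁ τ₂ L₁ L₂ (u₁ + ρ₁ * I) (u₂ + (-ω₂ : ℝ) * I)
          / (((u₁ : ℂ) + ρ₁ * I) * (u₂ + (-ω₂ : ℝ) * I))
      = (∫ u₂ : ℝ, chooserKernel ψ τ₁ τ₂ L₁ L₂ (u₁ + ρ₁ * I) (u₂ + ω₂ * I)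
          / (((u₁ : ℂ) + ρ₁ * I) * (u₂ + ω₂ * I)))
        + 2 * Real.pi * I *
          (chooserKernel ψ τ₁ τ₂ L₁ L₂ (u₁ + ρ₁ * I) 0 / ((u₁ : ℂ) + ρ₁ * I)) := by
    filter_upwards [hA.prod_right_ae, hD.prod_right_ae] with u₁ iA iD
    have hz : |((u₁ : ℂ) + ρ₁ * I).im| ≤ ω₁ := by simpa using hρ₁
    set z : ℂ := (u₁ : ℂ) + ρ₁ * I
    have hres := integral_div_line_eq_add_residue (B := B / ‖z‖)
      (g := fun w => chooserKernel ψ τ₁ τ₂ L₁ L₂ z w / z) hω₂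
      ((differentiableOn_chooserKernel_right hψ L₁ L₂ hlo hup hz).div_const z)
      (fun w hw => by
        rw [norm_div]
        gcongr
        exact hB z w hz hw)
      (by simpa only [div_div] using iA) (by simpa only [div_div] using iD)
    simpa only [div_div] using hres
  have hsum := integral_congr_ae key
  have hres : Integrable fun u₁ : ℝ => 2 * Real.pi * I *
      (chooserKernel ψ τ₁ τ₂ L₁ L₂ (u₁ + ρ₁ * I) 0 / ((u₁ : ℂ) + ρ₁ * I)) := by
    refine (hA.integral_prod_left.sub hD.integral_prod_left).congr ?_
    filter_upwards [key] with u₁ hu₁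
    simp only [Pi.sub_apply]
    rw [hu₁]
    ring
  refine (integral_integral_swap hA).symm.trans ?_
  rw [hsum, integral_add hD.integral_prod_left hres, integral_const_mul]
  congr 1
  exact integral_integral_swap hD

/-- Simplification of the chooser option price by residues: `A₁ = A₄ + (two single
contour integrals)`. -/
theorem stmt10 (lm lp ν : ℝ) (ψ : ℂ → ℂ) (hψ : IsAdmissibleCharExponent lm lp ν ψ)
    (hlm : lm < -1) (hlp : 0 < lp) (r : ℝ) (hr : (r : ℂ) + ψ (-Complex.I) = 0)
    (t T₁ T S K ω₁ ω₂ : ℝ) (ht : t < T₁) (hT : T₁ < T) (hS : 0 < S) (hK : 0 < K)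
    (hω₁ : 0 < ω₁) (hω₂ : 0 < ω₂) (hsum : ω₁ + ω₂ + 1 < min lp (-lm)) :
    chooserDbl ψ r t T₁ T (Real.log (S / K) + r * (T - T₁)) (Real.log (S / K)) S (-ω₁) (-ω₂)
      = chooserDbl ψ r t T₁ T (Real.log (S / K) + r * (T - T₁)) (Real.log (S / K)) S ω₁ ω₂
        + ((S : ℂ) * Real.exp (-r * (T - t)) / (2 * Real.pi * Complex.I)) *
          (∫ u₂ : ℝ,
            Complex.exp (Complex.I * ((u₂ : ℂ) - (ω₂ : ℂ) * Complex.I) * (Real.log (S / K) : ℝ)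
                - ((T - t : ℝ) : ℂ) * ψ (((u₂ : ℂ) - (ω₂ : ℂ) * Complex.I) - Complex.I))
              / ((u₂ : ℂ) - (ω₂ : ℂ) * Complex.I))
        + ((S : ℂ) * Real.exp (-r * (T₁ - t)) / (2 * Real.pi * Complex.I)) *
          (∫ u₁ : ℝ,
            Complex.exp (Complex.I * ((u₁ : ℂ) + (ω₁ : ℂ) * Complex.I)
                  * ((Real.log (S / K) + r * (T - T₁) : ℝ) : ℂ)
                - ((T₁ - t : ℝ) : ℂ) * ψ (((u₁ : ℂ) + (ω₁ : ℂ) * Complex.I) - Complex.I))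
              / ((u₁ : ℂ) + (ω₁ : ℂ) * Complex.I)) := by
  obtain ⟨hup, hlo⟩ := lt_min_iff.1 hsum
  have hτ₁ : 0 < T₁ - t := sub_pos.2 ht
  have hτ₂ : 0 < T - T₁ := sub_pos.2 hT
  set L₂ : ℝ := Real.log (S / K)
  set L₁ : ℝ := L₂ + r * (T - T₁)
  have hdbl : ∀ ρ₁ ρ₂ : ℝ, chooserDbl ψ r t T₁ T L₁ L₂ S ρ₁ ρ₂
      = ((S : ℂ) * Real.exp (-r * (T - t)) / (2 * Real.pi * Complex.I) ^ 2) *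
        ∫ u₂ : ℝ, ∫ u₁ : ℝ,
          chooserKernel ψ (T₁ - t) (T - T₁) L₁ L₂ (u₁ + ρ₁ * I) (u₂ + ρ₂ * I)
            / (((u₁ : ℂ) + ρ₁ * I) * (u₂ + ρ₂ * I)) := fun _ _ => rfl
  have hleft : ∀ u : ℝ, chooserKernel ψ (T₁ - t) (T - T₁) L₁ L₂ 0 (u + (-ω₂ : ℝ) * I)
        / ((u : ℂ) + (-ω₂ : ℝ) * I)
      = Complex.exp (I * ((u : ℂ) - ω₂ * I) * L₂
          - ((T - t : ℝ) : ℂ) * ψ (((u : ℂ) - ω₂ * I) - I)) / ((u : ℂ) - ω₂ * I) := by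
    intro u
    have hw : (u : ℂ) + (-ω₂ : ℝ) * I = u - ω₂ * I := by push_cast; ring
    rw [hw, chooserKernel, zero_add]
    congr 2
    push_cast
    ring
  have hψI : ψ (-I) = -(r : ℂ) := by linear_combination hr
  have hright : ∀ u : ℝ, chooserKernel ψ (T₁ - t) (T - T₁) L₁ L₂ (u + ω₁ * I) 0
        / ((u : ℂ) + ω₁ * I)
      = (Real.exp (r * (T - T₁)) : ℂ) * (Complex.exp (I * ((u : ℂ) + ω₁ * I) * L₁
          - ((T₁ - t : ℝ) : ℂ) * ψ (((u : ℂ) + ω₁ * I) - I)) / ((u : ℂ) + ω₁ * I)) := by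
    intro u
    rw [chooserKernel, zero_sub, hψI, ofReal_exp, ← mul_div_assoc, ← Complex.exp_add,
      ← sub_eq_add_neg]
    congr 2
    push_cast
    ring
  have hexp : (Real.exp (-r * (T₁ - t)) : ℂ)
      = Real.exp (-r * (T - t)) * Real.exp (r * (T - T₁)) := by
    rw [← ofReal_mul, ← Real.exp_add]
    congr 2
    ring
  have halg : ∀ s e f p x y z : ℂ, p ≠ 0 → s * e / p ^ 2 * (x + p * (f * z) + p * y)
      = s * e / p ^ 2 * x + s * e / p * y + s * (e * f) / p * z := by
    intro s e f p x y z hp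
    field_simp
    ring
  rw [hdbl, hdbl, integral_chooserKernel_shift_left hψ hτ₁ hτ₂ L₁ L₂ (by linarith) hup hω₁
      (neg_ne_zero.2 hω₂.ne') (by rw [abs_neg, abs_of_pos hω₂]),
    integral_chooserKernel_shift_right hψ hτ₁ hτ₂ L₁ L₂ (by linarith) hup hω₁ hω₂ hω₁.ne'
      (abs_of_pos hω₁).le]
  simp only [hleft, hright]
  rw [integral_const_mul, hexp]
  exact halg _ _ _ _ _ _ _ Complex.two_pi_I_ne_zero
end
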